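/- Let T ≥ 0 and let ρ be a Borel probability measure on [0,∞) with ρ({0}) = 0. Suppose F, G are bounded Borel functions on [0,T] and ε ∈ ℝ satisfy ‖F‖_∞ + |ε|·‖G‖_∞ ≤ 1/2. Then, with K[·] denoting the unique bounded solution of the convolutional Riccati equation K = (·) + ½(K²)*ρ, one has the perturbation expansion K[F + εG] = K[F] + Σ_{n≥1} ε^n K_n[K[F], G], where (K_n[K[F],G])_{n≥0} is the unique solution of the triangular system with B = K[F] and forcing G, and the series converges absolutely in supremum norm on [0,T]. -/

import Mathlib

open MeasureTheory

/-- The convolution of a function with a measure: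
`(g * ρ)(t) = ∫_{[0,t]} g(t-s) ρ(ds)`. -/
noncomputable def mconv (g : ℝ → ℝ) (ρ : Measure ℝ) (t : ℝ) : ℝ :=
  ∫ s in Set.Icc 0 t, g (t - s) ∂ρ

/-- The supremum norm of a function over `[0,T]`. -/
noncomputable def supNorm (g : ℝ → ℝ) (T : ℝ) : ℝ :=
  sSup ((fun t => |g t|) '' Set.Icc 0 T)

/-- `K : ℕ → ℝ → ℝ` is a bounded Borel solution on `[0,T]` of the infinite
triangular system `K₀ = B`, `K₁ = G + (K₀K₁)*ρ`,
`K_n = (½ Σ_{i=0}^{n} K_i K_{n-i})*ρ` for `n ≥ 2`. -/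
def SolvesSystem (T : ℝ) (ρ : Measure ℝ) (B G : ℝ → ℝ) (K : ℕ → ℝ → ℝ) : Prop :=
  (∀ n, Measurable (K n)) ∧
  (∀ n, ∃ M : ℝ, ∀ t ∈ Set.Icc 0 T, |K n t| ≤ M) ∧
  (∀ t ∈ Set.Icc 0 T, K 0 t = B t) ∧
  (∀ t ∈ Set.Icc 0 T, K 1 t = G t + mconv (fun u => K 0 u * K 1 u) ρ t) ∧
  (∀ n, 2 ≤ n → ∀ t ∈ Set.Icc 0 T,
    K n t = mconv (fun u => 2⁻¹ * ∑ i ∈ Finset.range (n + 1), K i u * K (n - i) u) ρ t)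

/-- `K` is a bounded Borel solution on `[0,T]` of the convolutional Riccati
equation `K = F + ½(K²)*ρ`. -/
def SolvesRiccati (T : ℝ) (ρ : Measure ℝ) (F K : ℝ → ℝ) : Prop :=
  Measurable K ∧ (∃ M : ℝ, ∀ t ∈ Set.Icc 0 T, |K t| ≤ M) ∧
  ∀ t ∈ Set.Icc 0 T, K t = F t + 2⁻¹ * mconv (fun u => (K u) ^ 2) ρ t

theorem mconv_integrable {T : ℝ} {ρ : Measure ℝ} [IsProbabilityMeasure ρ] {g : ℝ → ℝ}
    (hg : Measurable g) {M : ℝ} (hM : ∀ t ∈ Set.Icc 0 T, |g t| ≤ M) {t : ℝ}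
    (ht : t ∈ Set.Icc 0 T) :
    IntegrableOn (fun s => g (t - s)) (Set.Icc 0 t) ρ := by
  refine IntegrableOn.of_bound (measure_lt_top _ _)
    (hg.comp (measurable_const.sub measurable_id)).aestronglyMeasurable M ?_
  refine (ae_restrict_iff' measurableSet_Icc).2 (Filter.Eventually.of_forall fun s hs => ?_)
  exact hM _ ⟨by linarith [hs.2], by linarith [hs.1, ht.2]⟩

theorem mconv_congr {T : ℝ} {ρ : Measure ℝ} {g h : ℝ → ℝ}
    (hgh : ∀ t ∈ Set.Icc 0 T, g t = h t) {t : ℝ} (ht : t ∈ Set.Icc 0 T) :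
    mconv g ρ t = mconv h ρ t := by
  refine setIntegral_congr_fun measurableSet_Icc fun s hs => ?_
  exact hgh _ ⟨by linarith [hs.2], by linarith [hs.1, ht.2]⟩

theorem mconv_mono {T : ℝ} {ρ : Measure ℝ} [IsProbabilityMeasure ρ] {g h : ℝ → ℝ}
    (hg : Measurable g) {M : ℝ} (hM : ∀ t ∈ Set.Icc 0 T, |g t| ≤ M)
    (hh : Measurable h) {N : ℝ} (hN : ∀ t ∈ Set.Icc 0 T, |h t| ≤ N)
    (hgh : ∀ t ∈ Set.Icc 0 T, g t ≤ h t) {t : ℝ} (ht : t ∈ Set.Icc 0 T) :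
    mconv g ρ t ≤ mconv h ρ t := by
  refine setIntegral_mono_on (mconv_integrable hg hM ht) (mconv_integrable hh hN ht)
    measurableSet_Icc fun s hs => ?_
  exact hgh _ ⟨by linarith [hs.2], by linarith [hs.1, ht.2]⟩

theorem mconv_const_mul (c : ℝ) (g : ℝ → ℝ) (ρ : Measure ℝ) (t : ℝ) :
    mconv (fun u => c * g u) ρ t = c * mconv g ρ t :=
  integral_const_mul _ _

theorem mconv_const_le {ρ : Measure ℝ} [IsProbabilityMeasure ρ] {c : ℝ} (hc : 0 ≤ c) (t : ℝ) :
    mconv (fun _ => c) ρ t ≤ c := by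
  have h : ρ.real (Set.Icc 0 t) ≤ 1 := measureReal_le_one
  simp only [mconv, setIntegral_const, smul_eq_mul]
  nlinarith

theorem mconv_add {T : ℝ} {ρ : Measure ℝ} [IsProbabilityMeasure ρ] {g h : ℝ → ℝ}
    (hg : Measurable g) {M : ℝ} (hM : ∀ t ∈ Set.Icc 0 T, |g t| ≤ M)
    (hh : Measurable h) {N : ℝ} (hN : ∀ t ∈ Set.Icc 0 T, |h t| ≤ N)
    {t : ℝ} (ht : t ∈ Set.Icc 0 T) :
    mconv (fun u => g u + h u) ρ t = mconv g ρ t + mconv h ρ t :=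
  integral_add (mconv_integrable hg hM ht) (mconv_integrable hh hN ht)

theorem mconv_sub {T : ℝ} {ρ : Measure ℝ} [IsProbabilityMeasure ρ] {g h : ℝ → ℝ}
    (hg : Measurable g) {M : ℝ} (hM : ∀ t ∈ Set.Icc 0 T, |g t| ≤ M)
    (hh : Measurable h) {N : ℝ} (hN : ∀ t ∈ Set.Icc 0 T, |h t| ≤ N)
    {t : ℝ} (ht : t ∈ Set.Icc 0 T) :
    mconv (fun u => g u - h u) ρ t = mconv g ρ t - mconv h ρ t :=
  integral_sub (mconv_integrable hg hM ht) (mconv_integrable hh hN ht)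

theorem mconv_sum {T : ℝ} {ρ : Measure ℝ} [IsProbabilityMeasure ρ] {g : ℕ → ℝ → ℝ}
    (hg : ∀ n, Measurable (g n)) {M : ℕ → ℝ} (hM : ∀ n, ∀ t ∈ Set.Icc 0 T, |g n t| ≤ M n)
    (s : Finset ℕ) {t : ℝ} (ht : t ∈ Set.Icc 0 T) :
    mconv (fun u => ∑ n ∈ s, g n u) ρ t = ∑ n ∈ s, mconv (g n) ρ t :=
  integral_finsetSum s fun n _ => mconv_integrable (hg n) (hM n) ht

theorem abs_mconv_le (g : ℝ → ℝ) (ρ : Measure ℝ) (t : ℝ) :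
    |mconv g ρ t| ≤ mconv (fun u => |g u|) ρ t :=
  abs_integral_le_integral_abs

theorem abs_mconv_le_of_bound {T : ℝ} {ρ : Measure ℝ} [IsProbabilityMeasure ρ] {g : ℝ → ℝ}
    (hg : Measurable g) {M : ℝ} (hM0 : 0 ≤ M) (hM : ∀ t ∈ Set.Icc 0 T, |g t| ≤ M) {t : ℝ}
    (ht : t ∈ Set.Icc 0 T) : |mconv g ρ t| ≤ M := by
  refine (abs_mconv_le g ρ t).trans ((mconv_mono (M := M) (N := M) hg.abs ?_ measurable_const ?_
    hM ht).trans (mconv_const_le hM0 t))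
  · simpa using hM
  · intro _ _; rw [abs_of_nonneg hM0]

/-- The Laplace transform of a measure without atom at the origin vanishes at infinity. -/
theorem exists_laplace_le {ρ : Measure ℝ} [IsProbabilityMeasure ρ] (hρ0 : ρ {0} = 0)
    {η : ℝ} (hη : 0 < η) :
    ∃ l : ℝ, 0 ≤ l ∧ ∫ s in Set.Ici 0, Real.exp (-(l * s)) ∂ρ ≤ η := by
  have h : Filter.Tendsto (fun n : ℕ => ∫ s in Set.Ici 0, Real.exp (-((n : ℝ) * s)) ∂ρ)
      Filter.atTop (nhds (∫ _ in Set.Ici (0 : ℝ), (0 : ℝ) ∂ρ)) := by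
    refine tendsto_integral_of_dominated_convergence (fun _ => 1) (fun n => ?_)
      (integrable_const _) (fun n => ?_) ?_
    · exact (by fun_prop : Measurable fun s : ℝ => Real.exp (-((n : ℝ) * s))).aestronglyMeasurable
    · refine (ae_restrict_iff' measurableSet_Ici).2 (Filter.Eventually.of_forall fun s hs => ?_)
      have : 0 ≤ (n : ℝ) * s := mul_nonneg n.cast_nonneg hs
      simpa using this
    · refine (ae_restrict_iff' measurableSet_Ici).2 ?_
      have h0 : ∀ᵐ s ∂ρ, s ≠ 0 := by
        rw [ae_iff]; simpa using hρ0
      filter_upwards [h0] with s hs hs'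
      have hpos : 0 < s := lt_of_le_of_ne hs' (Ne.symm hs)
      refine Real.tendsto_exp_atBot.comp (Filter.tendsto_neg_atTop_atBot.comp ?_)
      exact tendsto_natCast_atTop_atTop.atTop_mul_const hpos
  rw [integral_zero] at h
  obtain ⟨n, hn⟩ := (h.eventually (ge_mem_nhds hη)).exists
  exact ⟨n, n.cast_nonneg, hn⟩

/-- A Grönwall inequality for convolution with a measure without atom at the origin. -/
theorem mconv_gronwall (T : ℝ) {ρ : Measure ℝ} [IsProbabilityMeasure ρ] (hρ0 : ρ {0} = 0)
    {C : ℝ} (hC : 0 ≤ C) :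
    ∃ A : ℝ, ∀ (v : ℝ → ℝ) (δ M : ℝ), Measurable v → 0 ≤ δ →
      (∀ t ∈ Set.Icc 0 T, 0 ≤ v t) → (∀ t ∈ Set.Icc 0 T, v t ≤ M) →
      (∀ t ∈ Set.Icc 0 T, v t ≤ δ + C * mconv v ρ t) →
      ∀ t ∈ Set.Icc 0 T, v t ≤ A * δ := by
  obtain ⟨l, hl, hle⟩ := exists_laplace_le hρ0 (η := 1 / (2 * (C + 1))) (by positivity)
  refine ⟨2 * Real.exp (l * T), fun v δ M hv hδ hv0 hvM hineq t ht => ?_⟩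
  have hM : 0 ≤ M := (hv0 t ht).trans (hvM t ht)
  have key : ∀ n : ℕ, ∀ t ∈ Set.Icc 0 T,
      v t ≤ Real.exp (l * t) * (2 * δ + M * (1 / 2) ^ n) := by
    intro n
    induction n with
    | zero =>
      intro t ht
      have : 1 ≤ Real.exp (l * t) := Real.one_le_exp (mul_nonneg hl ht.1)
      nlinarith [hvM t ht]
    | succ n ih =>
      intro t ht
      set B := 2 * δ + M * (1 / 2) ^ n with hB
      have hB0 : 0 ≤ B := by positivity
      have h1 : 1 ≤ Real.exp (l * t) := Real.one_le_exp (mul_nonneg hl ht.1)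
      have hexp : IntegrableOn (fun s => Real.exp (-(l * s))) (Set.Ici 0) ρ := by
        refine IntegrableOn.of_bound (measure_lt_top _ _)
          (by fun_prop : Measurable fun s : ℝ => Real.exp (-(l * s))).aestronglyMeasurable 1 ?_
        refine (ae_restrict_iff' measurableSet_Ici).2 (Filter.Eventually.of_forall fun s hs => ?_)
        have : 0 ≤ l * s := mul_nonneg hl hs
        simpa using this
      have h2 : mconv v ρ t ≤ ∫ s in Set.Icc 0 t, (Real.exp (l * t) * B) *
          Real.exp (-(l * s)) ∂ρ := by
        refine setIntegral_mono_on (mconv_integrable (M := M) hv ?_ ht)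
          ((hexp.mono_set Set.Icc_subset_Ici_self).const_mul _) measurableSet_Icc fun s hs => ?_
        · intro s hs
          rw [abs_of_nonneg (hv0 s hs)]; exact hvM s hs
        · refine (ih (t - s) ⟨by linarith [hs.2], by linarith [hs.1, ht.2]⟩).trans (le_of_eq ?_)
          rw [mul_sub, sub_eq_add_neg, Real.exp_add]; ring
      rw [integral_const_mul] at h2
      have h3 : ∫ s in Set.Icc 0 t, Real.exp (-(l * s)) ∂ρ ≤ 1 / (2 * (C + 1)) :=
        (setIntegral_mono_set hexp (Filter.Eventually.of_forall fun s => (Real.exp_pos _).le)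
          Set.Icc_subset_Ici_self.eventuallyLE).trans hle
      have h4 : mconv v ρ t ≤ (Real.exp (l * t) * B) * (1 / (2 * (C + 1))) :=
        h2.trans (mul_le_mul_of_nonneg_left h3 (by positivity))
      have h5 : C * mconv v ρ t ≤ (Real.exp (l * t) * B) * (1 / 2) := by
        refine (mul_le_mul_of_nonneg_left h4 hC).trans ?_
        have : C * (1 / (2 * (C + 1))) ≤ 1 / 2 := by
          rw [mul_one_div, div_le_div_iff₀ (by positivity) (by norm_num)]; linarith
        calc _ = (Real.exp (l * t) * B) * (C * (1 / (2 * (C + 1)))) := by ring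
          _ ≤ _ := mul_le_mul_of_nonneg_left this (by positivity)
      calc v t ≤ δ + C * mconv v ρ t := hineq t ht
        _ ≤ Real.exp (l * t) * δ + (Real.exp (l * t) * B) * (1 / 2) := by nlinarith
        _ = _ := by rw [hB, pow_succ]; ring
  have hlim : v t ≤ Real.exp (l * t) * (2 * δ + M * 0) :=
    ge_of_tendsto' (((tendsto_pow_atTop_nhds_zero_of_lt_one (by norm_num) (by norm_num)
      ).const_mul M).const_add (2 * δ) |>.const_mul (Real.exp (l * t))) fun n => key n t ht
  have : Real.exp (l * t) ≤ Real.exp (l * T) :=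
    Real.exp_le_exp.2 (mul_le_mul_of_nonneg_left ht.2 hl)
  nlinarith

/-- A bounded subsolution of the Riccati equation is dominated by the constant solution. -/
theorem le_of_riccati_subsolution {T : ℝ} {ρ : Measure ℝ} [IsProbabilityMeasure ρ]
    (hρ0 : ρ {0} = 0) {u : ℝ → ℝ} (hu : Measurable u) {M : ℝ} (hM : ∀ t ∈ Set.Icc 0 T, |u t| ≤ M)
    {a c : ℝ} (hc : 0 ≤ c) (hac : c = a + 2⁻¹ * c ^ 2)
    (hsub : ∀ t ∈ Set.Icc 0 T, |u t| ≤ a + 2⁻¹ * mconv (fun s => u s ^ 2) ρ t) :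
    ∀ t ∈ Set.Icc 0 T, |u t| ≤ c := by
  intro t ht
  have hM0 : 0 ≤ M := (abs_nonneg _).trans (hM t ht)
  have hC : 0 ≤ 2⁻¹ * (M + c) := by positivity
  obtain ⟨A, hA⟩ := mconv_gronwall T hρ0 hC
  have hvm : Measurable fun s => max (|u s| - c) 0 := by fun_prop
  have hvM : ∀ t ∈ Set.Icc 0 T, max (|u t| - c) 0 ≤ M := fun t ht =>
    max_le (by linarith [hM t ht]) hM0
  have := hA (fun s => max (|u s| - c) 0) 0 M hvm le_rfl (fun _ _ => le_max_right _ _)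
    hvM (fun t ht => ?_) t ht
  · have h := le_max_left (|u t| - c) 0
    linarith
  · have hu2 : ∀ t ∈ Set.Icc 0 T, |u t ^ 2| ≤ M ^ 2 := fun t ht => by
      rw [abs_pow]; exact pow_le_pow_left₀ (abs_nonneg _) (hM t ht) 2
    have h1 : mconv (fun s => u s ^ 2 - c ^ 2) ρ t ≤
        mconv (fun s => (M + c) * max (|u s| - c) 0) ρ t := by
      refine mconv_mono (M := M ^ 2 + c ^ 2) (N := (M + c) * M) (by fun_prop) ?_
        (hvm.const_mul _) ?_ ?_ ht
      · intro s hs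
        refine (abs_sub _ _).trans ?_
        rw [abs_of_nonneg (sq_nonneg c)]
        linarith [hu2 s hs]
      · intro s hs
        rw [abs_of_nonneg (by positivity)]
        exact mul_le_mul_of_nonneg_left (hvM s hs) (by positivity)
      · intro s hs
        have hx := hM s hs
        have h0 := abs_nonneg (u s)
        rw [← sq_abs (u s)]
        rcases le_total (|u s|) c with h | h
        · rw [max_eq_right (by linarith)]; nlinarith
        · rw [max_eq_left (by linarith)]; nlinarith
    rw [mconv_const_mul, mconv_sub (M := M ^ 2) (N := c ^ 2) (hu.pow_const 2) hu2
      measurable_const (fun _ _ => by rw [abs_of_nonneg (sq_nonneg c)]) ht] at h1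
    have h2 := mconv_const_le (ρ := ρ) (sq_nonneg c) t
    have h3 := hsub t ht
    have h4 : 0 ≤ mconv (fun s => max (|u s| - c) 0) ρ t :=
      integral_nonneg fun _ => le_max_right _ _
    refine max_le ?_ (by positivity)
    nlinarith

theorem sq_sum_sub_sum_cauchy (x : ℕ → ℝ) (N : ℕ) :
    (∑ i ∈ Finset.range N, x i) ^ 2 -
      ∑ n ∈ Finset.range N, ∑ i ∈ Finset.range (n + 1), x i * x (n - i) =
    ∑ m ∈ Finset.range N, ∑ k ∈ Finset.Ico (N - m) N, x m * x k := by
  rw [Finset.sum_range_diag_flip N (fun i j => x i * x j), sq, Finset.sum_mul_sum,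
    ← Finset.sum_sub_distrib]
  refine Finset.sum_congr rfl fun m _ => ?_
  rw [Finset.sum_Ico_eq_sub _ (Nat.sub_le N m)]

theorem sum_cauchy_le_sq_sum {x : ℕ → ℝ} (hx : ∀ n, 0 ≤ x n) (N : ℕ) :
    ∑ n ∈ Finset.range N, ∑ i ∈ Finset.range (n + 1), x i * x (n - i) ≤
      (∑ i ∈ Finset.range N, x i) ^ 2 := by
  have h := sq_sum_sub_sum_cauchy x N
  have : 0 ≤ ∑ m ∈ Finset.range N, ∑ k ∈ Finset.Ico (N - m) N, x m * x k :=
    Finset.sum_nonneg fun m _ => Finset.sum_nonneg fun k _ => mul_nonneg (hx m) (hx k)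
  linarith

theorem abs_sq_sum_sub_sum_cauchy_le {x p : ℕ → ℝ} (hx : ∀ n, |x n| ≤ p n) (N : ℕ) :
    |(∑ i ∈ Finset.range N, x i) ^ 2 -
      ∑ n ∈ Finset.range N, ∑ i ∈ Finset.range (n + 1), x i * x (n - i)| ≤
    (∑ i ∈ Finset.range N, p i) ^ 2 -
      ∑ n ∈ Finset.range N, ∑ i ∈ Finset.range (n + 1), p i * p (n - i) := by
  rw [sq_sum_sub_sum_cauchy, sq_sum_sub_sum_cauchy]
  refine (Finset.abs_sum_le_sum_abs _ _).trans (Finset.sum_le_sum fun m _ => ?_)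
  refine (Finset.abs_sum_le_sum_abs _ _).trans (Finset.sum_le_sum fun k _ => ?_)
  rw [abs_mul]
  exact mul_le_mul (hx m) (hx k) (abs_nonneg _) ((abs_nonneg _).trans (hx m))

/-- The majorant bound: a sequence dominated by the coefficients of a quadratic fixed point
equation has partial sums dominated by the increment of the fixed point. -/
theorem sum_le_of_quadratic_recursion {p : ℕ → ℝ} (hp : ∀ n, 0 ≤ p n) {b c q : ℝ}
    (hpc : p 0 ≤ c) (hc : c < 1) (hq : 0 ≤ q) (hcq : (1 - c) * q = b + 2⁻¹ * q ^ 2)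
    (h1 : ∀ n, p (n + 1) ≤ (if n = 0 then b else 0) +
      2⁻¹ * ∑ i ∈ Finset.range (n + 2), p i * p (n + 1 - i)) (N : ℕ) :
    ∑ n ∈ Finset.range N, p (n + 1) ≤ q := by
  have hsplit : ∀ n, ∑ i ∈ Finset.range (n + 2), p i * p (n + 1 - i) =
      2 * (p 0 * p (n + 1)) + ∑ i ∈ Finset.range n, p (i + 1) * p (n - i) := by
    intro n
    rw [Finset.sum_range_succ, Finset.sum_range_succ']
    simp only [Nat.add_sub_add_right, Nat.sub_self, Nat.sub_zero]
    ring
  induction N with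
  | zero => simpa using hq
  | succ N ih =>
    have h2 : ∑ n ∈ Finset.range (N + 1), (1 - p 0) * p (n + 1) ≤
        ∑ n ∈ Finset.range (N + 1), ((if n = 0 then b else 0) +
          2⁻¹ * ∑ i ∈ Finset.range n, p (i + 1) * p (n - i)) := by
      refine Finset.sum_le_sum fun n _ => ?_
      have := h1 n
      rw [hsplit] at this
      linarith
    rw [← Finset.mul_sum, Finset.sum_add_distrib, ← Finset.mul_sum, Finset.sum_ite_eq'] at h2
    rw [Finset.sum_range_succ' (fun n => ∑ i ∈ Finset.range n, p (i + 1) * p (n - i)) N] at h2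
    have h3 : ∑ n ∈ Finset.range N, ∑ i ∈ Finset.range (n + 1), p (i + 1) * p (n + 1 - i) ≤
        (∑ i ∈ Finset.range N, p (i + 1)) ^ 2 := by
      refine le_of_eq_of_le ?_ (sum_cauchy_le_sq_sum (fun n => hp (n + 1)) N)
      refine Finset.sum_congr rfl fun n _ => Finset.sum_congr rfl fun i hi => ?_
      rw [Finset.mem_range] at hi
      rw [Nat.sub_add_comm (by omega)]
    have h4 : (∑ i ∈ Finset.range N, p (i + 1)) ^ 2 ≤ q ^ 2 :=
      pow_le_pow_left₀ (Finset.sum_nonneg fun i _ => hp _) ih 2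
    have h5 : 0 ≤ ∑ n ∈ Finset.range (N + 1), p (n + 1) := Finset.sum_nonneg fun i _ => hp _
    simp at h2
    have h6 : (1 - c) * ∑ n ∈ Finset.range (N + 1), p (n + 1) ≤ (1 - c) * q := by nlinarith
    exact le_of_mul_le_mul_left h6 (by linarith)

theorem abs_le_supNorm {g : ℝ → ℝ} {T : ℝ} (hg : ∃ M : ℝ, ∀ t ∈ Set.Icc 0 T, |g t| ≤ M) {t : ℝ}
    (ht : t ∈ Set.Icc 0 T) : |g t| ≤ supNorm g T := by
  obtain ⟨M, hM⟩ := hg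
  exact le_csSup ⟨M, by rintro _ ⟨s, hs, rfl⟩; exact hM s hs⟩ ⟨t, ht, rfl⟩

theorem supNorm_le {g : ℝ → ℝ} {T M : ℝ} (hT : 0 ≤ T) (hM : ∀ t ∈ Set.Icc 0 T, |g t| ≤ M) :
    supNorm g T ≤ M :=
  csSup_le ⟨_, ⟨0, ⟨le_rfl, hT⟩, rfl⟩⟩ (by rintro _ ⟨s, hs, rfl⟩; exact hM s hs)

theorem supNorm_nonneg (g : ℝ → ℝ) (T : ℝ) : 0 ≤ supNorm g T :=
  Real.sSup_nonneg (by rintro _ ⟨s, _, rfl⟩; exact abs_nonneg _)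

theorem supNorm_const_mul (c : ℝ) (g : ℝ → ℝ) (T : ℝ) :
    supNorm (fun t => c * g t) T = |c| * supNorm g T := by
  unfold supNorm
  rw [← smul_eq_mul, ← Real.sSup_smul_of_nonneg (abs_nonneg c), ← Set.image_smul, Set.image_image]
  simp only [abs_mul, smul_eq_mul]

/-- Summability of the sup norms of the solution of the scaled triangular system. -/
theorem summable_of_triangular {T : ℝ} {ρ : Measure ℝ} [IsProbabilityMeasure ρ]
    (hT : 0 ≤ T) (hρ0 : ρ {0} = 0) {f k : ℕ → ℝ → ℝ} (hk : ∀ n, Measurable (k n))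
    (hkb : ∀ n, ∃ M : ℝ, ∀ t ∈ Set.Icc 0 T, |k n t| ≤ M)
    {a b : ℝ} (ha : 0 ≤ a) (hb : 0 ≤ b) (hab : a + b ≤ 1 / 2)
    (hf0 : ∀ t ∈ Set.Icc 0 T, |f 0 t| ≤ a) (hf1 : ∀ t ∈ Set.Icc 0 T, |f 1 t| ≤ b)
    (hf2 : ∀ n, 2 ≤ n → ∀ t, f n t = 0)
    (hsys : ∀ n, ∀ t ∈ Set.Icc 0 T, k n t = f n t +
      mconv (fun u => 2⁻¹ * ∑ i ∈ Finset.range (n + 1), k i u * k (n - i) u) ρ t) :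
    Summable fun n => supNorm (k n) T := by
  rw [← summable_nat_add_iff 1]
  have hp : ∀ n, ∀ t ∈ Set.Icc 0 T, |k n t| ≤ supNorm (k n) T :=
    fun n t ht => abs_le_supNorm (hkb n) ht
  have hp0 : ∀ n, 0 ≤ supNorm (k n) T := fun n => supNorm_nonneg _ _
  have hfn : ∀ n, ∀ t ∈ Set.Icc 0 T, |f (n + 1) t| ≤ if n = 0 then b else 0 := by
    intro n t ht
    rcases n with _ | n
    · simpa using hf1 t ht
    · simp [hf2 (n + 1 + 1) (by omega)]
  rcases hb.eq_or_lt with rfl | hbpos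
  · have hz : ∀ n, 1 ≤ n → ∀ t ∈ Set.Icc 0 T, k n t = 0 := by
      intro n
      induction n using Nat.strong_induction_on with
      | _ n ih =>
        intro hn t ht
        obtain ⟨m, rfl⟩ : ∃ m, n = m + 1 := ⟨n - 1, by omega⟩
        obtain ⟨A, hA⟩ := mconv_gronwall T hρ0 (hp0 0)
        have := hA (fun s => |k (m + 1) s|) 0 _ (hk _).abs le_rfl (fun _ _ => abs_nonneg _)
          (hp (m + 1)) (fun t ht => ?_) t ht
        · rw [mul_zero] at this
          exact abs_nonpos_iff.1 this
        · have hft : f (m + 1) t = 0 := by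
            have := hfn m t ht
            simpa using this
          have hcongr : mconv (fun u => 2⁻¹ * ∑ i ∈ Finset.range (m + 1 + 1),
              k i u * k (m + 1 - i) u) ρ t = mconv (fun u => k 0 u * k (m + 1) u) ρ t := by
            refine mconv_congr (fun s hs => ?_) ht
            rw [Finset.sum_range_succ, Finset.sum_range_succ', Finset.sum_eq_zero]
            · simp only [Nat.sub_self, Nat.sub_zero]; ring
            · intro i hi
              rw [Finset.mem_range] at hi
              rw [ih (i + 1) (by omega) (by omega) s hs, zero_mul]
          rw [hsys _ t ht, hft, hcongr, zero_add, zero_add, ← mconv_const_mul]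
          refine (abs_mconv_le _ _ _).trans ?_
          have hle : ∀ s ∈ Set.Icc 0 T, |k 0 s * k (m + 1) s| ≤
              supNorm (k 0) T * |k (m + 1) s| := fun s hs => by
            rw [abs_mul]
            exact mul_le_mul_of_nonneg_right (hp 0 s hs) (abs_nonneg _)
          have hle' : ∀ s ∈ Set.Icc 0 T, supNorm (k 0) T * |k (m + 1) s| ≤
              supNorm (k 0) T * supNorm (k (m + 1)) T := fun s hs =>
            mul_le_mul_of_nonneg_left (hp _ s hs) (hp0 0)
          refine mconv_mono (M := supNorm (k 0) T * supNorm (k (m + 1)) T)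
            (N := supNorm (k 0) T * supNorm (k (m + 1)) T) ((hk 0).mul (hk _)).abs ?_
            ((hk _).abs.const_mul _) ?_ hle ht
          · intro s hs
            rw [abs_abs]; exact (hle s hs).trans (hle' s hs)
          · intro s hs
            rw [abs_of_nonneg (mul_nonneg (hp0 0) (abs_nonneg _))]; exact hle' s hs
    have : (fun n => supNorm (k (n + 1)) T) = fun _ => 0 := by
      funext n
      refine le_antisymm (supNorm_le hT fun t ht => ?_) (hp0 _)
      rw [hz (n + 1) (by omega) t ht, abs_zero]
    rw [this]
    exact summable_zero
  · have hsq : ∀ x : ℝ, x ≤ 1 / 2 → 1 - √(1 - 2 * x) = x + 2⁻¹ * (1 - √(1 - 2 * x)) ^ 2 := by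
      intro x hx
      have := Real.sq_sqrt (show 0 ≤ 1 - 2 * x by linarith)
      nlinarith
    set c := 1 - √(1 - 2 * a) with hc
    set d := 1 - √(1 - 2 * (a + b)) with hd
    have hca : c = a + 2⁻¹ * c ^ 2 := hsq a (by linarith)
    have hdab : d = a + b + 2⁻¹ * d ^ 2 := hsq (a + b) hab
    have hc0 : 0 ≤ c := by nlinarith [sq_nonneg c]
    have hc1 : c < 1 := by
      have : 0 < √(1 - 2 * a) := Real.sqrt_pos.2 (by linarith)
      linarith
    have hcd : c ≤ d := by
      have : √(1 - 2 * (a + b)) ≤ √(1 - 2 * a) := Real.sqrt_le_sqrt (by linarith)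
      linarith
    have hpc : supNorm (k 0) T ≤ c := by
      refine supNorm_le hT (le_of_riccati_subsolution hρ0 (hk 0) (hp 0) hc0 hca fun t ht => ?_)
      rw [hsys 0 t ht]
      have h0 : 0 ≤ mconv (fun s => k 0 s ^ 2) ρ t := integral_nonneg fun _ => sq_nonneg _
      refine (abs_add_le _ _).trans (add_le_add (hf0 t ht) (le_of_eq ?_))
      simp only [zero_add, Finset.sum_range_one, Nat.sub_zero, mconv_const_mul, ← sq]
      exact abs_of_nonneg (by positivity)
    refine summable_of_sum_range_le (c := d - c) (fun n => hp0 _)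
      (sum_le_of_quadratic_recursion (b := b) hp0 hpc hc1 (by linarith) (by nlinarith) fun n => ?_)
    refine supNorm_le hT fun t ht => ?_
    rw [hsys _ t ht]
    refine (abs_add_le _ _).trans (add_le_add (hfn n t ht) ?_)
    refine abs_mconv_le_of_bound ?_ ?_ ?_ ht
    · exact (Finset.measurable_fun_sum _ fun i _ => (hk i).mul (hk _)).const_mul _
    · exact mul_nonneg (by norm_num)
        (Finset.sum_nonneg fun i _ => mul_nonneg (hp0 _) (hp0 _))
    · intro s hs
      rw [abs_mul, abs_of_pos (by norm_num : (0 : ℝ) < 2⁻¹)]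
      refine mul_le_mul_of_nonneg_left ?_ (by norm_num)
      refine (Finset.abs_sum_le_sum_abs _ _).trans (Finset.sum_le_sum fun i _ => ?_)
      rw [abs_mul]
      exact mul_le_mul (hp _ s hs) (hp _ s hs) (abs_nonneg _) (hp0 _)

/-- If the sup norms of the solution of the scaled triangular system are summable, then the
partial sums converge to any bounded solution of the Riccati equation. -/
theorem tendsto_sum_of_triangular {T : ℝ} {ρ : Measure ℝ} [IsProbabilityMeasure ρ]
    (hρ0 : ρ {0} = 0) {f k : ℕ → ℝ → ℝ} (hk : ∀ n, Measurable (k n))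
    (hkb : ∀ n, ∃ M : ℝ, ∀ t ∈ Set.Icc 0 T, |k n t| ≤ M)
    (hf2 : ∀ n, 2 ≤ n → ∀ t, f n t = 0)
    (hsys : ∀ n, ∀ t ∈ Set.Icc 0 T, k n t = f n t +
      mconv (fun u => 2⁻¹ * ∑ i ∈ Finset.range (n + 1), k i u * k (n - i) u) ρ t)
    (hsum : Summable fun n => supNorm (k n) T)
    {H : ℝ → ℝ} (hH : SolvesRiccati T ρ (fun t => f 0 t + f 1 t) H) {t : ℝ}
    (ht : t ∈ Set.Icc 0 T) :
    Filter.Tendsto (fun N => ∑ n ∈ Finset.range N, k n t) Filter.atTop (nhds (H t)) := by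
  obtain ⟨hHm, ⟨M, hM⟩, hHeq⟩ := hH
  set p : ℕ → ℝ := fun n => supNorm (k n) T with hpdef
  have hp : ∀ n, ∀ t ∈ Set.Icc 0 T, |k n t| ≤ p n :=
    fun n t ht => abs_le_supNorm (hkb n) ht
  have hp0 : ∀ n, 0 ≤ p n := fun n => supNorm_nonneg _ _
  have hM0 : 0 ≤ M := (abs_nonneg _).trans (hM t ht)
  set P := ∑' n, p n with hP
  have hP0 : 0 ≤ P := tsum_nonneg hp0
  set δ : ℕ → ℝ := fun N => 2⁻¹ * ((∑ i ∈ Finset.range N, p i) ^ 2 -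
      ∑ n ∈ Finset.range N, ∑ i ∈ Finset.range (n + 1), p i * p (n - i)) with hδ
  have hδ0 : ∀ N, 0 ≤ δ N := fun N =>
    mul_nonneg (by norm_num) (by linarith [sum_cauchy_le_sq_sum hp0 N])
  have hδlim : Filter.Tendsto δ Filter.atTop (nhds 0) := by
    have hn : Summable fun n => ‖p n‖ := hsum.norm
    have h1 := (hsum.hasSum.tendsto_sum_nat).pow 2
    have h2 := (hasSum_sum_range_mul_of_summable_norm hn hn).tendsto_sum_nat
    have h3 := (h1.sub h2).const_mul (2⁻¹ : ℝ)
    rwa [sq, sub_self, mul_zero] at h3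
  obtain ⟨A, hA⟩ := mconv_gronwall T hρ0 (C := 2⁻¹ * (M + P)) (by positivity)
  have hLb : ∀ N, ∀ s ∈ Set.Icc 0 T, |∑ n ∈ Finset.range N, k n s| ≤ P := fun N s hs =>
    (Finset.abs_sum_le_sum_abs _ _).trans ((Finset.sum_le_sum fun n _ => hp n s hs).trans
      (hsum.sum_le_tsum _ fun n _ => hp0 n))
  have hLm : ∀ N, Measurable fun s => ∑ n ∈ Finset.range N, k n s := fun N =>
    Finset.measurable_fun_sum _ fun n _ => hk n
  have hcm : ∀ n, Measurable fun u => 2⁻¹ * ∑ i ∈ Finset.range (n + 1), k i u * k (n - i) u :=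
    fun n => (Finset.measurable_fun_sum _ fun i _ => (hk i).mul (hk _)).const_mul _
  have hcb : ∀ n, ∀ s ∈ Set.Icc 0 T,
      |2⁻¹ * ∑ i ∈ Finset.range (n + 1), k i s * k (n - i) s| ≤
        2⁻¹ * ∑ i ∈ Finset.range (n + 1), p i * p (n - i) := by
    intro n s hs
    rw [abs_mul, abs_of_pos (by norm_num : (0 : ℝ) < 2⁻¹)]
    refine mul_le_mul_of_nonneg_left ?_ (by norm_num)
    refine (Finset.abs_sum_le_sum_abs _ _).trans (Finset.sum_le_sum fun i _ => ?_)
    rw [abs_mul]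
    exact mul_le_mul (hp _ s hs) (hp _ s hs) (abs_nonneg _) (hp0 _)
  have hmain : ∀ N, 2 ≤ N → |H t - ∑ n ∈ Finset.range N, k n t| ≤ A * δ N := by
    intro N hN
    have hdiffb : ∀ s ∈ Set.Icc 0 T, |H s - ∑ n ∈ Finset.range N, k n s| ≤ M + P :=
      fun s hs => (abs_sub _ _).trans (add_le_add (hM s hs) (hLb N s hs))
    refine hA (fun s => |H s - ∑ n ∈ Finset.range N, k n s|) (δ N) (M + P)
      (hHm.sub (hLm N)).abs (hδ0 N) (fun _ _ => abs_nonneg _) hdiffb (fun t ht => ?_) t ht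
    have hf : ∑ n ∈ Finset.range N, f n t = f 0 t + f 1 t := by
      obtain ⟨m, rfl⟩ : ∃ m, N = m + 1 + 1 := ⟨N - 2, by omega⟩
      rw [Finset.sum_range_succ', Finset.sum_range_succ', Finset.sum_eq_zero]
      · ring
      · intro i _
        exact hf2 _ (by omega) t
    have hL : ∑ n ∈ Finset.range N, k n t = f 0 t + f 1 t +
        mconv (fun u => ∑ n ∈ Finset.range N,
          2⁻¹ * ∑ i ∈ Finset.range (n + 1), k i u * k (n - i) u) ρ t := by
      rw [mconv_sum hcm hcb _ ht, ← hf, ← Finset.sum_add_distrib]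
      exact Finset.sum_congr rfl fun n _ => hsys n t ht
    have hDm : Measurable fun u => ∑ n ∈ Finset.range N,
          2⁻¹ * ∑ i ∈ Finset.range (n + 1), k i u * k (n - i) u :=
      Finset.measurable_fun_sum _ fun n _ => hcm n
    have hDb : ∀ s ∈ Set.Icc 0 T, |∑ n ∈ Finset.range N,
          2⁻¹ * ∑ i ∈ Finset.range (n + 1), k i s * k (n - i) s| ≤
        ∑ n ∈ Finset.range N, 2⁻¹ * ∑ i ∈ Finset.range (n + 1), p i * p (n - i) :=
      fun s hs => (Finset.abs_sum_le_sum_abs _ _).trans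
        (Finset.sum_le_sum fun n _ => hcb n s hs)
    have hHb : ∀ s ∈ Set.Icc 0 T, |2⁻¹ * H s ^ 2| ≤ 2⁻¹ * M ^ 2 := fun s hs => by
      rw [abs_of_nonneg (by positivity), ← sq_abs]
      exact mul_le_mul_of_nonneg_left (pow_le_pow_left₀ (abs_nonneg _) (hM s hs) 2) (by norm_num)
    have hvb : ∀ s ∈ Set.Icc 0 T, |2⁻¹ * (M + P) * (|H s - ∑ n ∈ Finset.range N, k n s|)| ≤
        2⁻¹ * (M + P) * (M + P) := fun s hs => by
      rw [abs_of_nonneg (by positivity)]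
      exact mul_le_mul_of_nonneg_left (hdiffb s hs) (by positivity)
    have hvm : Measurable fun s => 2⁻¹ * (M + P) * |H s - ∑ n ∈ Finset.range N, k n s| :=
      (hHm.sub (hLm N)).abs.const_mul _
    have hδb : ∀ s ∈ Set.Icc 0 T, |δ N| ≤ δ N := fun _ _ => (abs_of_nonneg (hδ0 N)).le
    have hEq : H t - ∑ n ∈ Finset.range N, k n t = mconv (fun u => 2⁻¹ * H u ^ 2 -
        ∑ n ∈ Finset.range N, 2⁻¹ * ∑ i ∈ Finset.range (n + 1), k i u * k (n - i) u) ρ t := by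
      rw [mconv_sub ((hHm.pow_const 2).const_mul _) hHb hDm hDb ht, mconv_const_mul, hL,
        hHeq t ht]
      ring
    change |H t - ∑ n ∈ Finset.range N, k n t| ≤ _
    rw [hEq]
    refine (abs_mconv_le _ _ _).trans ?_
    have hstep : ∀ s ∈ Set.Icc 0 T, |2⁻¹ * H s ^ 2 -
        ∑ n ∈ Finset.range N, 2⁻¹ * ∑ i ∈ Finset.range (n + 1), k i s * k (n - i) s| ≤
        δ N + 2⁻¹ * (M + P) * |H s - ∑ n ∈ Finset.range N, k n s| := by
      intro s hs
      have e1 := abs_sq_sum_sub_sum_cauchy_le (fun n => hp n s hs) N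
      set L := ∑ n ∈ Finset.range N, k n s with hLdef
      rw [← Finset.mul_sum]
      set D := ∑ n ∈ Finset.range N, ∑ i ∈ Finset.range (n + 1), k i s * k (n - i) s
      have e2 : 2⁻¹ * H s ^ 2 - 2⁻¹ * D = 2⁻¹ * (L ^ 2 - D) + 2⁻¹ * ((H s + L) * (H s - L)) := by
        ring
      have e3 : |H s + L| ≤ M + P :=
        (abs_add_le _ _).trans (add_le_add (hM s hs) (hLb N s hs))
      rw [e2]
      refine (abs_add_le _ _).trans (add_le_add ?_ ?_)
      · rw [abs_mul, abs_of_pos (by norm_num : (0 : ℝ) < 2⁻¹)]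
        exact mul_le_mul_of_nonneg_left e1 (by norm_num)
      · rw [abs_mul, abs_mul, abs_of_pos (by norm_num : (0 : ℝ) < 2⁻¹), mul_assoc]
        exact mul_le_mul_of_nonneg_left
          (mul_le_mul_of_nonneg_right e3 (abs_nonneg _)) (by norm_num)
    have hsumb : ∀ s ∈ Set.Icc 0 T,
        |δ N + 2⁻¹ * (M + P) * (|H s - ∑ n ∈ Finset.range N, k n s|)| ≤
        δ N + 2⁻¹ * (M + P) * (M + P) := fun s hs =>
      (abs_add_le _ _).trans (add_le_add (hδb s hs) (hvb s hs))
    refine (mconv_mono (M := δ N + 2⁻¹ * (M + P) * (M + P))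
      (((hHm.pow_const 2).const_mul _).sub hDm).abs (fun s hs => ?_)
      (hvm.const_add _) hsumb hstep ht).trans ?_
    · rw [abs_abs]
      exact (hstep s hs).trans ((le_abs_self _).trans (hsumb s hs))
    · rw [mconv_add measurable_const hδb hvm hvb ht,
        mconv_const_mul (2⁻¹ * (M + P))]
      exact add_le_add (mconv_const_le (hδ0 N) t) le_rfl
  rw [tendsto_iff_norm_sub_tendsto_zero]
  have hAδ : Filter.Tendsto (fun N => A * δ N) Filter.atTop (nhds 0) := by
    simpa using hδlim.const_mul A
  refine squeeze_zero' (Filter.Eventually.of_forall fun _ => norm_nonneg _) ?_ hAδ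
  filter_upwards [Filter.eventually_ge_atTop 2] with N hN
  rw [norm_sub_rev]
  exact hmain N hN

/-- Perturbation expansion for the convolutional Riccati equation:
if `‖F‖_∞ + |ε|‖G‖_∞ ≤ 1/2`, `KF` solves the Riccati equation with forcing `F`,
`KFG` solves it with forcing `F + εG`, and `(Ksys_n)` solves the triangular
system with `B = KF` and forcing `G`, then
`KFG = KF + Σ_{n≥1} εⁿ Ksys_n` on `[0,T]`, the series converging absolutely in
supremum norm. -/
theorem stmt_15 (T : ℝ) (hT : 0 ≤ T)
    (ρ : Measure ℝ) [IsProbabilityMeasure ρ]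
    (hρ0 : ρ {0} = 0) (hρpos : ρ (Set.Iio 0) = 0)
    (F G : ℝ → ℝ) (hFmeas : Measurable F) (hGmeas : Measurable G)
    (hFbdd : ∃ M : ℝ, ∀ t ∈ Set.Icc 0 T, |F t| ≤ M)
    (hGbdd : ∃ M : ℝ, ∀ t ∈ Set.Icc 0 T, |G t| ≤ M)
    (ε : ℝ) (hsmall : supNorm F T + |ε| * supNorm G T ≤ 1 / 2)
    (KF : ℝ → ℝ) (hKF : SolvesRiccati T ρ F KF)
    (KFG : ℝ → ℝ) (hKFG : SolvesRiccati T ρ (fun t => F t + ε * G t) KFG)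
    (Ksys : ℕ → ℝ → ℝ) (hKsys : SolvesSystem T ρ KF G Ksys) :
    Summable (fun n : ℕ => |ε| ^ (n + 1) * supNorm (Ksys (n + 1)) T) ∧
    ∀ t ∈ Set.Icc 0 T,
      KFG t = KF t + ∑' n : ℕ, ε ^ (n + 1) * Ksys (n + 1) t := by
  obtain ⟨hKm, hKb, hK0, hK1, hK2⟩ := hKsys
  set k : ℕ → ℝ → ℝ := fun n t => ε ^ n * Ksys n t with hkdef
  set f : ℕ → ℝ → ℝ := fun n t => if n = 0 then F t else if n = 1 then ε * G t else 0 with hfdef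
  have hkm : ∀ n, Measurable (k n) := fun n => (hKm n).const_mul _
  have hkb : ∀ n, ∃ M : ℝ, ∀ t ∈ Set.Icc 0 T, |k n t| ≤ M := fun n => by
    obtain ⟨M, hM⟩ := hKb n
    refine ⟨|ε ^ n| * M, fun t ht => ?_⟩
    rw [hkdef, abs_mul]
    exact mul_le_mul_of_nonneg_left (hM t ht) (abs_nonneg _)
  have hf2 : ∀ n, 2 ≤ n → ∀ t, f n t = 0 := fun n hn t => by
    simp only [hfdef]
    rw [if_neg (by omega), if_neg (by omega)]
  have hprod : ∀ n u, 2⁻¹ * ∑ i ∈ Finset.range (n + 1), k i u * k (n - i) u =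
      ε ^ n * (2⁻¹ * ∑ i ∈ Finset.range (n + 1), Ksys i u * Ksys (n - i) u) := by
    intro n u
    rw [mul_left_comm, Finset.mul_sum (a := ε ^ n)]
    congr 1
    refine Finset.sum_congr rfl fun i hi => ?_
    rw [Finset.mem_range] at hi
    have : ε ^ n = ε ^ i * ε ^ (n - i) := by rw [← pow_add]; congr 1; omega
    rw [this]
    simp only [hkdef]
    ring
  have hsys : ∀ n, ∀ t ∈ Set.Icc 0 T, k n t = f n t +
      mconv (fun u => 2⁻¹ * ∑ i ∈ Finset.range (n + 1), k i u * k (n - i) u) ρ t := by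
    intro n t ht
    simp only [hprod, mconv_const_mul (ε ^ n)]
    rcases n with _ | _ | n
    · have h : mconv (fun u => KF u ^ 2) ρ t = mconv (fun u => Ksys 0 u * Ksys 0 u) ρ t :=
        mconv_congr (fun s hs => by rw [hK0 s hs, sq]) ht
      simp [hkdef, hfdef, hK0 t ht, hKF.2.2 t ht, mconv_const_mul, h]
    · have h : mconv (fun u => 2⁻¹ * ∑ i ∈ Finset.range (0 + 1 + 1),
          Ksys i u * Ksys (0 + 1 - i) u) ρ t = mconv (fun u => Ksys 0 u * Ksys 1 u) ρ t :=
        mconv_congr (fun s _ => by simp [Finset.sum_range_succ]; ring) ht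
      rw [h]
      have h1 := hK1 t ht
      simp only [hkdef, hfdef, zero_add, pow_one, one_ne_zero, if_true, if_false]
      rw [h1]
      ring
    · have h1 := hK2 (n + 1 + 1) (by omega) t ht
      rw [hf2 _ (by omega), zero_add, ← h1]
  have hsum : Summable fun n => supNorm (k n) T := by
    refine summable_of_triangular (f := f) hT hρ0 hkm hkb (supNorm_nonneg F T)
      (mul_nonneg (abs_nonneg ε) (supNorm_nonneg G T)) hsmall (fun t ht => ?_) (fun t ht => ?_)
      hf2 hsys
    · simpa [hfdef] using abs_le_supNorm hFbdd ht
    · simp only [hfdef, one_ne_zero, if_true, if_false, abs_mul]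
      exact mul_le_mul_of_nonneg_left (abs_le_supNorm hGbdd ht) (abs_nonneg _)
  have hsum' := (summable_nat_add_iff 1).2 hsum
  refine ⟨?_, fun t ht => ?_⟩
  · simpa only [hkdef, supNorm_const_mul, abs_pow] using hsum'
  · have hH : SolvesRiccati T ρ (fun t => f 0 t + f 1 t) KFG := by simpa [hfdef] using hKFG
    have hlim := tendsto_sum_of_triangular hρ0 hkm hkb hf2 hsys hsum hH ht
    have hst : Summable fun n => k n t :=
      Summable.of_norm_bounded hsum fun n => abs_le_supNorm (hkb n) ht
    rw [tendsto_nhds_unique hlim hst.hasSum.tendsto_sum_nat, hst.tsum_eq_zero_add]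
    simp [hkdef, hK0 t ht]
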